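/- arXiv:0910.4887 — 2 statements merged into one kernel-verified Lean document; each statement's English description precedes it below -/
import Mathlib

section
/- Let B be an m×n complex matrix, let W be an n×d complex matrix satisfying W W^H = I_n (a Parseval frame condition), and let μ > 0. Then B B^H + μI_m and W^H B^H B W + μI_d are both invertible, and (W^H B^H B W + μI_d)^{−1} = (1/μ)·(I_d − W^H B^H (B B^H + μI_m)^{−1} B W). -/
open Matrix

/-- Sherman–Morrison–Woodbury inversion for the SALSA synthesis-prior update:
if W Wᴴ = I (Parseval frame) and μ > 0, then
(Wᴴ Bᴴ B W + μI)⁻¹ = (1/μ)(I − Wᴴ Bᴴ (B Bᴴ + μI)⁻¹ B W). -/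
theorem smw_parseval_frame_inverse
    (m n d : ℕ) (B : Matrix (Fin m) (Fin n) ℂ) (W : Matrix (Fin n) (Fin d) ℂ)
    (hW : W * Wᴴ = 1) (μ : ℝ) (hμ : 0 < μ) :
    IsUnit (B * Bᴴ + (μ : ℂ) • 1) ∧
    IsUnit (Wᴴ * Bᴴ * B * W + (μ : ℂ) • 1) ∧
    (Wᴴ * Bᴴ * B * W + (μ : ℂ) • 1)⁻¹
      = (μ : ℂ)⁻¹ • (1 - Wᴴ * Bᴴ * (B * Bᴴ + (μ : ℂ) • 1)⁻¹ * B * W) := by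
  have hmu_ne : (μ : ℂ) ≠ 0 := by exact_mod_cast (ne_of_gt hμ)
  have key : ∀ (k l : ℕ) (A : Matrix (Fin k) (Fin l) ℂ),
      IsUnit (A * Aᴴ + (μ : ℂ) • (1 : Matrix (Fin k) (Fin k) ℂ)) := by
    intro k l A
    open scoped ComplexOrder in
    exact (Matrix.PosDef.posSemidef_add (posSemidef_self_mul_conjTranspose A)
      (Matrix.PosDef.one.smul (Complex.zero_lt_real.2 hμ))).isUnit
  have h1 := key m n B
  have h2 : IsUnit (Wᴴ * Bᴴ * B * W + (μ : ℂ) • (1 : Matrix (Fin d) (Fin d) ℂ)) := by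
    have h := key d m (Wᴴ * Bᴴ)
    simpa [Matrix.conjTranspose_mul, Matrix.mul_assoc] using h
  refine ⟨h1, h2, ?_⟩
  apply Matrix.inv_eq_right_inv
  have hX := Matrix.mul_nonsing_inv _ ((Matrix.isUnit_iff_isUnit_det _).1 h1)
  set X := (B * Bᴴ + (μ : ℂ) • (1 : Matrix (Fin m) (Fin m) ℂ))⁻¹
  have e1 : Wᴴ * Bᴴ * B * W * (Wᴴ * Bᴴ * X * B * W)
      = Wᴴ * Bᴴ * (B * Bᴴ * X) * B * W := by
    calc _ = Wᴴ * Bᴴ * B * (W * Wᴴ) * Bᴴ * X * B * W := by simp only [Matrix.mul_assoc]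
      _ = _ := by rw [hW]; simp only [Matrix.mul_assoc, Matrix.one_mul]
  have e2 : B * Bᴴ * X = 1 - (μ : ℂ) • X := by
    rw [← hX, Matrix.add_mul, Matrix.smul_mul, Matrix.one_mul, add_sub_cancel_right]
  have e3 : (Wᴴ * Bᴴ * B * W + (μ : ℂ) • 1) * (1 - Wᴴ * Bᴴ * X * B * W)
      = (μ : ℂ) • (1 : Matrix (Fin d) (Fin d) ℂ) := by
    rw [Matrix.add_mul, Matrix.mul_sub, e1, e2]
    simp only [Matrix.mul_sub, Matrix.sub_mul, Matrix.mul_one, Matrix.mul_smul,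
      Matrix.smul_mul, Matrix.one_mul]
    abel
  rw [Matrix.mul_smul, e3, smul_smul, inv_mul_cancel₀ hmu_ne, one_smul]
end

section
/- Let U be an n×n complex unitary matrix, let D be an n×n complex diagonal matrix, let B = U^H D U, let W be an n×d complex matrix with W W^H = I_n, and let μ > 0. Then W^H B^H B W + μI_d is invertible and (W^H B^H B W + μI_d)^{−1} = (1/μ)·(I_d − W^H U^H D^H (D D^H + μI_n)^{−1} D U W). -/
open Matrix

open scoped ComplexOrder in
theorem salsa_aux {n d : ℕ} (C : Matrix (Fin n) (Fin d) ℂ) (μ : ℝ) (hμ : 0 < μ) :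
    (Cᴴ * C + (μ : ℂ) • 1) *
      ((μ : ℂ)⁻¹ • (1 - Cᴴ * (C * Cᴴ + (μ : ℂ) • 1)⁻¹ * C)) = 1 := by
  have hμ' : (μ : ℂ) ≠ 0 := by exact_mod_cast hμ.ne'
  have hpos : (C * Cᴴ + (μ : ℂ) • (1 : Matrix (Fin n) (Fin n) ℂ)).PosDef := by
    apply Matrix.PosDef.posSemidef_add (Matrix.posSemidef_self_mul_conjTranspose C)
    exact Matrix.PosDef.one.smul (by exact_mod_cast hμ)
  have hinv := Matrix.mul_nonsing_inv _ ((Matrix.isUnit_iff_isUnit_det _).1 hpos.isUnit)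
  generalize (C * Cᴴ + (μ : ℂ) • (1 : Matrix (Fin n) (Fin n) ℂ))⁻¹ = N at hinv ⊢
  have key : (Cᴴ * C + (μ : ℂ) • 1) * (Cᴴ * N * C) = Cᴴ * C := by
    calc _ = Cᴴ * ((C * Cᴴ + (μ : ℂ) • 1) * N) * C := by
            simp only [Matrix.add_mul, Matrix.mul_add, Matrix.smul_mul, Matrix.mul_smul,
              Matrix.one_mul, Matrix.mul_assoc]
      _ = _ := by rw [hinv, Matrix.mul_one]
  rw [Matrix.mul_smul, Matrix.mul_sub, key, Matrix.mul_one, add_sub_cancel_left, smul_smul,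
    inv_mul_cancel₀ hμ', one_smul]

/-- Closed form of the SALSA regularized inverse for frame-based synthesis
deconvolution: with B = Uᴴ D U (U unitary, D diagonal) and W Wᴴ = I,
(Wᴴ Bᴴ B W + μI)⁻¹ = (1/μ)(I − Wᴴ Uᴴ Dᴴ (D Dᴴ + μI)⁻¹ D U W). -/
theorem salsa_synthesis_deconvolution_inverse
    (n d : ℕ) (U D : Matrix (Fin n) (Fin n) ℂ)
    (hU₁ : U * Uᴴ = 1) (hU₂ : Uᴴ * U = 1) (hD : D.IsDiag)
    (B : Matrix (Fin n) (Fin n) ℂ) (hB : B = Uᴴ * D * U)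
    (W : Matrix (Fin n) (Fin d) ℂ) (hW : W * Wᴴ = 1)
    (μ : ℝ) (hμ : 0 < μ) :
    IsUnit (Wᴴ * Bᴴ * B * W + (μ : ℂ) • 1) ∧
    (Wᴴ * Bᴴ * B * W + (μ : ℂ) • 1)⁻¹
      = (μ : ℂ)⁻¹ • (1 - Wᴴ * Uᴴ * Dᴴ * (D * Dᴴ + (μ : ℂ) • 1)⁻¹ * D * U * W) := by
  have h1 : Wᴴ * Bᴴ * B * W = (D * U * W)ᴴ * (D * U * W) := by
    subst hB
    calc _ = Wᴴ * Uᴴ * Dᴴ * (U * Uᴴ) * D * U * W := by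
            simp only [Matrix.conjTranspose_mul, Matrix.conjTranspose_conjTranspose,
              Matrix.mul_assoc]
      _ = _ := by
            rw [hU₁]
            simp only [Matrix.conjTranspose_mul, Matrix.mul_one, Matrix.mul_assoc]
  have h2 : D * Dᴴ = (D * U * W) * (D * U * W)ᴴ := by
    symm
    calc _ = D * (U * (W * Wᴴ) * Uᴴ) * Dᴴ := by
            simp only [Matrix.conjTranspose_mul, Matrix.mul_assoc]
      _ = _ := by rw [hW, Matrix.mul_one, hU₁, Matrix.mul_one]
  have h3 := salsa_aux (D * U * W) μ hμ
  rw [← h1, ← h2] at h3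
  have h4 : Wᴴ * Uᴴ * Dᴴ * (D * Dᴴ + (μ : ℂ) • 1)⁻¹ * D * U * W
      = (D * U * W)ᴴ * (D * Dᴴ + (μ : ℂ) • 1)⁻¹ * (D * U * W) := by
    simp only [Matrix.conjTranspose_mul, Matrix.mul_assoc]
  rw [h4]
  exact ⟨IsUnit.of_mul_eq_one _ h3, Matrix.inv_eq_right_inv h3⟩
end
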